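/- No crossing job exists, i.e., B1 ∩ B2 = ∅: no job j has both x_{j1} and x_{j2} non-integer. -/

import Mathlib

open Finset

noncomputable section

/-- Feasibility for system `S`. -/
def FeasibleS {J M : Type*} [Fintype J] [Fintype M]
    (G1 G2 : Finset M) (b : J → M → ℕ) (a1 a2 : J → ℕ)
    (y : J → M → ℝ) (x1 x2 : J → ℝ) (r w : ℝ) : Prop :=
  (∀ h ∈ G1, ((∑ j, (b j h : ℝ)) - ((∑ j, (a2 j : ℝ)) - r) ≤ (∑ j, y j h)) ∧
    ((∑ j, y j h) ≤ w)) ∧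
  (∀ h ∈ G2, ((∑ j, (b j h : ℝ)) - ((∑ j, (a1 j : ℝ)) - r) ≤ (∑ j, y j h)) ∧
    ((∑ j, y j h) ≤ w)) ∧
  (∀ j, (∑ h, y j h) ≤ w) ∧
  (∀ j, ∀ h, 0 ≤ y j h ∧ y j h ≤ (b j h : ℝ)) ∧
  ((∑ j, x1 j) = r) ∧ ((∑ j, x2 j) = r) ∧
  (∀ j, x1 j + x2 j ≤ r) ∧
  (∀ j, 0 ≤ x1 j ∧ x1 j ≤ (a1 j : ℝ)) ∧
  (∀ j, 0 ≤ x2 j ∧ x2 j ≤ (a2 j : ℝ)) ∧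
  (∀ j, (∑ h ∈ G1, ((b j h : ℝ) - y j h)) + (a2 j : ℝ) - x2 j ≤ (∑ j', (a2 j' : ℝ)) - r) ∧
  (∀ j, (∑ h ∈ G2, ((b j h : ℝ) - y j h)) + (a1 j : ℝ) - x1 j ≤ (∑ j', (a1 j' : ℝ)) - r)

/-- Feasibility for the linear program `ℓp` associated with an optimal
LP-relaxation value `(rstar, wstar)`. -/
def FeasibleLP {J M : Type*} [Fintype J] [Fintype M]
    (G1 G2 : Finset M) (b : J → M → ℕ) (a1 a2 : J → ℕ)
    (rstar wstar : ℝ)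
    (y : J → M → ℝ) (x1 x2 : J → ℝ) (r w : ℝ) : Prop :=
  FeasibleS G1 G2 b a1 a2 y x1 x2 r w ∧
  w - r = (⌈wstar - rstar⌉ : ℝ) ∧ ((⌊rstar⌋ : ℝ) ≤ r)





lemma path_flow {N : Type*} [Fintype N] [DecidableEq N] (R : N → N → Prop) {a b : N}
    (h : Relation.ReflTransGen R a b) :
    ∃ e : N → N → ℝ, (∀ u v, 0 ≤ e u v) ∧ (∀ u v, ¬ R u v → e u v = 0) ∧
      ∀ u, (∑ v, e u v) - ∑ v, e v u = (if a = u then 1 else 0) - (if b = u then 1 else 0) := by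
  induction h with
  | refl => exact ⟨fun _ _ => 0, by simp, by simp, by simp⟩
  | @tail c d hac hcd ih =>
    obtain ⟨e, h1, h2, h3⟩ := ih
    refine ⟨fun u v => e u v + if c = u ∧ d = v then 1 else 0, ?_, ?_, ?_⟩
    · intro u v
      have := h1 u v
      dsimp only
      split_ifs <;> linarith
    · intro u v huv
      have : ¬ (c = u ∧ d = v) := by
        rintro ⟨rfl, rfl⟩
        exact huv hcd
      simp [h2 u v huv, this]
    · intro u
      have e1 : (∑ v, if c = u ∧ d = v then (1:ℝ) else 0) = if c = u then 1 else 0 := by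
        by_cases hc : c = u <;> simp [hc]
      have e2 : (∑ v, if c = v ∧ d = u then (1:ℝ) else 0) = if d = u then 1 else 0 := by
        by_cases hc : d = u <;> simp [hc]
      simp only [sum_add_distrib, e1, e2]
      linarith [h3 u]

lemma sig_count {N : Type*} [Fintype N] [DecidableEq N] (k : N → ℕ) (u : N) :
    (∑ d : (Σ a, Fin (k a)), if d.1 = u then (1:ℝ) else 0) = k u := by
  rw [Fintype.sum_sigma, Fintype.sum_eq_single u]
  · simp
  · intro a ha
    simp [ha]

lemma transship {N : Type*} [Fintype N] [DecidableEq N] (R : N → N → Prop) (σ : N → ℤ)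
    (h0 : ∑ a, σ a = 0)
    (hT : ∀ T : Finset N, (∀ a b, R a b → b ∈ T → a ∈ T) → 0 ≤ ∑ a ∈ T, σ a) :
    ∃ e : N → N → ℝ, (∀ u v, 0 ≤ e u v) ∧ (∀ u v, ¬ R u v → e u v = 0) ∧
      ∀ u, (∑ v, e u v) - ∑ v, e v u = σ u := by
  classical
  let ι := Σ a : N, Fin (-σ a).toNat
  let α := Σ a : N, Fin (σ a).toNat
  have key : ∀ T : Finset N, ∑ a ∈ T, σ a =
      ((∑ a ∈ T, (σ a).toNat : ℕ) : ℤ) - ((∑ a ∈ T, (-σ a).toNat : ℕ) : ℤ) := by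
    intro T
    push_cast
    rw [← sum_sub_distrib]
    apply sum_congr rfl
    intro a _
    omega
  have hall : ∃ f : ι → α, Function.Injective f ∧ ∀ d, Relation.ReflTransGen R (f d).1 d.1 := by
    have := (Fintype.all_card_le_filter_rel_iff_exists_injective
      (fun (d : ι) (s : α) => Relation.ReflTransGen R s.1 d.1)).1
    apply this
    intro A
    let T : Finset N := univ.filter fun a => ∃ d ∈ A, Relation.ReflTransGen R a d.1
    have hTc := hT T (by
      intro a b hab hb
      simp only [T, mem_filter, mem_univ, true_and] at hb ⊢
      obtain ⟨d, hd, hbd⟩ := hb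
      exact ⟨d, hd, Relation.ReflTransGen.head hab hbd⟩)
    rw [key] at hTc
    have c1 : A.card ≤ ∑ a ∈ T, (-σ a).toNat := by
      have : A ⊆ T.sigma (fun a => (univ : Finset (Fin (-σ a).toNat))) := by
        intro d hd
        exact mem_sigma.2 ⟨mem_filter.2 ⟨mem_univ _, d, hd, Relation.ReflTransGen.refl⟩, mem_univ _⟩
      have := card_le_card this
      rw [card_sigma] at this
      simpa using this
    have c2 : ∑ a ∈ T, (σ a).toNat ≤
        (univ.filter fun s : α => ∃ d ∈ A, Relation.ReflTransGen R s.1 d.1).card := by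
      have : T.sigma (fun a => (univ : Finset (Fin (σ a).toNat))) ⊆
          (univ.filter fun s : α => ∃ d ∈ A, Relation.ReflTransGen R s.1 d.1) := by
        intro s hs
        simp only [mem_sigma, mem_univ, and_true, T, mem_filter, true_and] at hs ⊢
        exact hs
      have := card_le_card this
      simpa [card_sigma] using this
    omega
  obtain ⟨f, hf, hr⟩ := hall
  have hcard : Fintype.card ι = Fintype.card α := by
    have := key univ
    rw [h0] at this
    simp only [ι, α, Fintype.card_sigma, Fintype.card_fin]
    omega
  have hbij : Function.Bijective f := (Fintype.bijective_iff_injective_and_card f).2 ⟨hf, hcard⟩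
  choose e h1 h2 h3 using fun d => path_flow R (hr d)
  refine ⟨fun u v => ∑ d, e d u v, fun u v => sum_nonneg fun d _ => h1 d u v,
    fun u v huv => sum_eq_zero fun d _ => h2 d u v huv, ?_⟩
  intro u
  rw [sum_comm, sum_comm (f := fun v d => e d v u), ← sum_sub_distrib]
  simp only [h3]
  rw [sum_sub_distrib]
  have s1 : (∑ d : ι, if (f d).1 = u then (1:ℝ) else 0) = ((σ u).toNat : ℝ) := by
    rw [Function.Bijective.sum_comp hbij (fun s : α => if s.1 = u then (1:ℝ) else 0)]
    exact sig_count (fun a => (σ a).toNat) u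
  have s2 : (∑ d : ι, if d.1 = u then (1:ℝ) else 0) = ((-σ u).toNat : ℝ) := by
    exact sig_count (fun a => (-σ a).toNat) u
  rw [s1, s2]
  have : (σ u) = ((σ u).toNat : ℤ) - ((-σ u).toNat : ℤ) := by omega
  conv_rhs => rw [this]
  push_cast
  rfl

/-- Context. -/
structure Ctx {J M : Type*} [Fintype J] [Fintype M]
    (G1 G2 : Finset M) (b : J → M → ℝ) (c1 c2 : J → ℤ) (D : ℤ)
    (y : J → M → ℝ) (x1 x2 : J → ℝ) (r w : ℝ) : Prop where
  disj : Disjoint G1 G2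
  cover : ∀ h, h ∈ G1 ∨ h ∈ G2
  hw : w = r + D
  hr : ∀ z : ℤ, r ≠ z
  rpos : 0 < r
  wpos : 0 < w
  col : ∀ h, ∑ j, y j h = w
  hA : ∀ j, ∑ h ∈ G1, y j h + ∑ h ∈ G2, y j h ≤ w
  y0 : ∀ j h, 0 ≤ y j h
  yb : ∀ j h, y j h ≤ b j h
  s1 : ∑ j, x1 j = r
  s2 : ∑ j, x2 j = r
  hB : ∀ j, x1 j + x2 j ≤ r
  x10 : ∀ j, 0 ≤ x1 j
  x20 : ∀ j, 0 ≤ x2 j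
  hC : ∀ j, c1 j + r - x2 j ≤ ∑ h ∈ G1, y j h
  hD : ∀ j, c2 j + r - x1 j ≤ ∑ h ∈ G2, y j h
  no : ∀ (dy : J → M → ℝ) (v1 v2 : J → ℝ), ∑ j, v1 j = 1 → ∑ j, v2 j = 1 →
    (∀ j, 0 ≤ v1 j) → (∀ j, 0 ≤ v2 j) → (∀ j, v1 j ≠ 0 → 0 < x1 j) → (∀ j, v2 j ≠ 0 → 0 < x2 j) →
    (∀ j, x1 j + x2 j = r → 1 ≤ v1 j + v2 j) →
    (∀ h, ∑ j, dy j h = -1) →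
    (∀ j, ∑ h ∈ G1, y j h + ∑ h ∈ G2, y j h = w →
      ∑ h ∈ G1, dy j h + ∑ h ∈ G2, dy j h ≤ -1) →
    (∀ j h, y j h = b j h → dy j h ≤ 0) → (∀ j h, y j h = 0 → 0 ≤ dy j h) →
    (∀ j, c1 j + r - x2 j = ∑ h ∈ G1, y j h → -1 + v2 j ≤ ∑ h ∈ G1, dy j h) →
    (∀ j, c2 j + r - x1 j = ∑ h ∈ G2, y j h → -1 + v1 j ≤ ∑ h ∈ G2, dy j h) → False

/-- Nodes of the residual network: source, jobs, (job, group 1), (job, group 2), machines. -/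
abbrev Nd (J M : Type*) := Unit ⊕ J ⊕ J ⊕ J ⊕ M

abbrev nS {J M : Type*} : Nd J M := Sum.inl ()
abbrev nJ {J M : Type*} (j : J) : Nd J M := Sum.inr (Sum.inl j)
abbrev n1 {J M : Type*} (j : J) : Nd J M := Sum.inr (Sum.inr (Sum.inl j))
abbrev n2 {J M : Type*} (j : J) : Nd J M := Sum.inr (Sum.inr (Sum.inr (Sum.inl j)))
abbrev nM {J M : Type*} (h : M) : Nd J M := Sum.inr (Sum.inr (Sum.inr (Sum.inr h)))

/-- Residual arcs. -/
inductive Arc {J M : Type*} 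
    (G1 G2 : Finset M) (b : J → M → ℝ) (c1 c2 : J → ℤ)
    (y : J → M → ℝ) (x1 x2 : J → ℝ) (r w : ℝ) : Nd J M → Nd J M → Prop
  | sj (j : J) (_ : ∑ h ∈ G1, y j h + ∑ h ∈ G2, y j h ≠ w) : Arc G1 G2 b c1 c2 y x1 x2 r w nS (nJ j)
  | js (j : J) : Arc G1 G2 b c1 c2 y x1 x2 r w (nJ j) nS
  | j1 (j : J) : Arc G1 G2 b c1 c2 y x1 x2 r w (nJ j) (n1 j)
  | j2 (j : J) : Arc G1 G2 b c1 c2 y x1 x2 r w (nJ j) (n2 j)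
  | k1 (j : J) (_ : c1 j + r - x2 j ≠ ∑ h ∈ G1, y j h) :
      Arc G1 G2 b c1 c2 y x1 x2 r w (n1 j) (nJ j)
  | k2 (j : J) (_ : c2 j + r - x1 j ≠ ∑ h ∈ G2, y j h) :
      Arc G1 G2 b c1 c2 y x1 x2 r w (n2 j) (nJ j)
  | u1 (j : J) (h : M) (_ : h ∈ G1) (_ : y j h ≠ b j h) :
      Arc G1 G2 b c1 c2 y x1 x2 r w (n1 j) (nM h)
  | u2 (j : J) (h : M) (_ : h ∈ G2) (_ : y j h ≠ b j h) :
      Arc G1 G2 b c1 c2 y x1 x2 r w (n2 j) (nM h)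
  | d1 (j : J) (h : M) (_ : h ∈ G1) (_ : y j h ≠ 0) :
      Arc G1 G2 b c1 c2 y x1 x2 r w (nM h) (n1 j)
  | d2 (j : J) (h : M) (_ : h ∈ G2) (_ : y j h ≠ 0) :
      Arc G1 G2 b c1 c2 y x1 x2 r w (nM h) (n2 j)

def Cl {J M : Type*}
    (G1 G2 : Finset M) (b : J → M → ℝ) (c1 c2 : J → ℤ)
    (y : J → M → ℝ) (x1 x2 : J → ℝ) (r w : ℝ) (T : Finset (Nd J M)) : Prop :=
  ∀ u v, Arc G1 G2 b c1 c2 y x1 x2 r w u v → v ∈ T → u ∈ T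

/-- Supplies. -/
def sup2 {J M : Type*} [Fintype J] [Fintype M] (p1 p2 : J → ℤ) : Nd J M → ℤ :=
  Sum.elim (fun _ => 2 * ((Fintype.card J : ℤ) - Fintype.card M))
    (Sum.elim (fun j => 2 - p1 j - p2 j) (Sum.elim (fun j => p2 j - 2)
      (Sum.elim (fun j => p1 j - 2) (fun _ => 2))))

def tau {J M : Type*} [Fintype J] [Fintype M] : Nd J M → ℤ :=
  Sum.elim (fun _ => ((Fintype.card J : ℤ) - Fintype.card M))
    (Sum.elim (fun _ => 1) (Sum.elim (fun _ => -1)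
      (Sum.elim (fun _ => -1) (fun _ => 1))))

def kap {J M : Type*} [Fintype J] [Fintype M] (T : Finset (Nd J M)) : ℤ := ∑ a ∈ T, tau a

open Classical in
def ii {J M : Type*} (T : Finset (Nd J M)) (a : Nd J M) : ℤ := if a ∈ T then 1 else 0

def Cc {J M : Type*} (T : Finset (Nd J M)) (j : J) : ℤ := ii T (nJ j) - ii T (n1 j)
def Dd {J M : Type*} (T : Finset (Nd J M)) (j : J) : ℤ := ii T (nJ j) - ii T (n2 j)

section
variable {J M : Type*} [Fintype J] [Fintype M]

lemma sum_ii (T : Finset (Nd J M)) (f : Nd J M → ℤ) :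
    ∑ a ∈ T, f a = ∑ a, ii T a * f a := by
  classical
  simp [ii, Finset.sum_ite_mem]

lemma sum_nd {A : Type*} [AddCommMonoid A] (f : Nd J M → A) : ∑ a, f a =
    f nS + (∑ j, f (nJ j) + (∑ j, f (n1 j) + (∑ j, f (n2 j) + ∑ h, f (nM h)))) := by
  simp [Fintype.sum_sum_type]

lemma kap_eq (T : Finset (Nd J M)) : kap T =
    ii T nS * ((Fintype.card J : ℤ) - Fintype.card M) + ∑ j, ii T (nJ j) - ∑ j, ii T (n1 j)
      - ∑ j, ii T (n2 j) + ∑ h, ii T (nM h) := by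
  rw [kap, sum_ii, sum_nd]
  simp only [tau, Sum.elim_inl, Sum.elim_inr, mul_one, mul_neg, sum_neg_distrib]
  ring

lemma sup_eq (T : Finset (Nd J M)) (p1 p2 : J → ℤ) : ∑ a ∈ T, sup2 p1 p2 a =
    2 * kap T - ∑ j, (Cc T j * p2 j + Dd T j * p1 j) := by
  rw [kap_eq, sum_ii, sum_nd]
  have e1 : ∑ j : J, ii T (nJ j) * (2 - p1 j - p2 j) + (∑ j, ii T (n1 j) * (p2 j - 2)
      + ∑ j, ii T (n2 j) * (p1 j - 2)) + ∑ j, (Cc T j * p2 j + Dd T j * p1 j)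
      = 2 * (∑ j, ii T (nJ j) - ∑ j, ii T (n1 j) - ∑ j, ii T (n2 j)) := by
    rw [mul_sub, mul_sub, mul_sum, mul_sum, mul_sum, ← sum_sub_distrib, ← sum_sub_distrib,
      ← sum_add_distrib, ← sum_add_distrib, ← sum_add_distrib]
    refine sum_congr rfl fun j _ => ?_
    simp only [Cc, Dd]
    ring
  simp only [sup2, Sum.elim_inl, Sum.elim_inr, ← sum_mul]
  linarith

variable {G1 G2 : Finset M} {b : J → M → ℝ} {c1 c2 : J → ℤ} {D : ℤ}
    {y : J → M → ℝ} {x1 x2 : J → ℝ} {r w : ℝ}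

lemma Ctx.swap (c : Ctx G1 G2 b c1 c2 D y x1 x2 r w) : Ctx G2 G1 b c2 c1 D y x2 x1 r w where
  disj := c.disj.symm
  cover h := (c.cover h).symm
  hw := c.hw
  hr := c.hr
  rpos := c.rpos
  wpos := c.wpos
  col := c.col
  hA j := by rw [add_comm]; exact c.hA j
  y0 := c.y0
  yb := c.yb
  s1 := c.s2
  s2 := c.s1
  hB j := by rw [add_comm]; exact c.hB j
  x10 := c.x20
  x20 := c.x10
  hC := c.hD
  hD := c.hC
  no dy v1 v2 a1 a2 a3 a4 a5 a6 a7 a8 a9 a10 a11 a12 a13 := by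
    refine c.no dy v2 v1 a2 a1 a4 a3 a6 a5 ?_ a8 ?_ a10 a11 a13 a12
    · intro j hj
      have := a7 j (by linarith)
      linarith
    · intro j hj
      have := a9 j (by linarith)
      linarith

lemma dirfail (c : Ctx G1 G2 b c1 c2 D y x1 x2 r w) (p1 p2 : J → ℤ)
    (h1 : ∑ j, p1 j = 2) (h2 : ∑ j, p2 j = 2) (q1 : ∀ j, 0 ≤ p1 j) (q2 : ∀ j, 0 ≤ p2 j)
    (z1 : ∀ j, p1 j ≠ 0 → 0 < x1 j) (z2 : ∀ j, p2 j ≠ 0 → 0 < x2 j)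
    (ht : ∀ j, x1 j + x2 j = r → 2 ≤ p1 j + p2 j) :
    ∃ T, Cl G1 G2 b c1 c2 y x1 x2 r w T ∧ 2 * kap T < ∑ j, (Cc T j * p2 j + Dd T j * p1 j) := by
  classical
  by_contra hcon
  push Not at hcon
  obtain ⟨e, e0, eR, eb⟩ := transship (Arc G1 G2 b c1 c2 y x1 x2 r w) (sup2 p1 p2)
    (by
      rw [sum_nd]
      simp only [sup2, Sum.elim_inl, Sum.elim_inr, sum_sub_distrib, h1, h2]
      simp
      ring)
    (by
      intro T hT
      rw [sup_eq]
      have := hcon T hT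
      linarith)
  have bM : ∀ h, (∑ j, e (nM h) (n1 j) + ∑ j, e (nM h) (n2 j))
      - (∑ j, e (n1 j) (nM h) + ∑ j, e (n2 j) (nM h)) = 2 := by
    intro h
    have := eb (nM h)
    rw [sum_nd, sum_nd] at this
    have t1 : e (nM h) nS = 0 := eR _ _ (by rintro ⟨⟩)
    have t2 : ∀ j, e (nM h) (nJ j) = 0 := fun j => eR _ _ (by rintro ⟨⟩)
    have t3 : ∀ j, e (nM h) (nM j) = 0 := fun j => eR _ _ (by rintro ⟨⟩)
    have t4 : e nS (nM h) = 0 := eR _ _ (by rintro ⟨⟩)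
    have t5 : ∀ j, e (nJ j) (nM h) = 0 := fun j => eR _ _ (by rintro ⟨⟩)
    have t6 : ∀ j, e (nM j) (nM h) = 0 := fun j => eR _ _ (by rintro ⟨⟩)
    simp only [t1, t2, t3, t4, t5, t6, sum_const_zero, sup2, Sum.elim_inr] at this
    push_cast at this
    linarith
  have bJ : ∀ j, e (nJ j) nS + e (nJ j) (n1 j) + e (nJ j) (n2 j)
      - (e nS (nJ j) + e (n1 j) (nJ j) + e (n2 j) (nJ j)) = 2 - p1 j - p2 j := by
    intro j
    have := eb (nJ j)
    rw [sum_nd, sum_nd] at this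
    have t1 : ∀ i, e (nJ j) (nJ i) = 0 := fun i => eR _ _ (by rintro ⟨⟩)
    have t1' : ∀ i, e (nJ i) (nJ j) = 0 := fun i => eR _ _ (by rintro ⟨⟩)
    have t2 : ∀ i, e (nJ j) (nM i) = 0 := fun i => eR _ _ (by rintro ⟨⟩)
    have t3 : ∀ i, e (nM i) (nJ j) = 0 := fun i => eR _ _ (by rintro ⟨⟩)
    have t4 : ∑ i, e (nJ j) (n1 i) = e (nJ j) (n1 j) :=
      Fintype.sum_eq_single j fun i hi => eR _ _ (by rintro ⟨⟩; exact hi rfl)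
    have t5 : ∑ i, e (nJ j) (n2 i) = e (nJ j) (n2 j) :=
      Fintype.sum_eq_single j fun i hi => eR _ _ (by rintro ⟨⟩; exact hi rfl)
    have t6 : ∑ i, e (n1 i) (nJ j) = e (n1 j) (nJ j) :=
      Fintype.sum_eq_single j fun i hi => eR _ _ (by rintro ⟨⟩; exact hi rfl)
    have t7 : ∑ i, e (n2 i) (nJ j) = e (n2 j) (nJ j) :=
      Fintype.sum_eq_single j fun i hi => eR _ _ (by rintro ⟨⟩; exact hi rfl)
    simp only [t1, t1', t2, t3, t4, t5, t6, t7, sum_const_zero, sup2, Sum.elim_inr,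
      Sum.elim_inl] at this
    push_cast at this
    linarith
  have b1 : ∀ j, e (n1 j) (nJ j) + ∑ h, e (n1 j) (nM h)
      - (e (nJ j) (n1 j) + ∑ h, e (nM h) (n1 j)) = p2 j - 2 := by
    intro j
    have := eb (n1 j)
    rw [sum_nd, sum_nd] at this
    have t1 : e (n1 j) nS = 0 := eR _ _ (by rintro ⟨⟩)
    have t1' : e nS (n1 j) = 0 := eR _ _ (by rintro ⟨⟩)
    have t2 : ∀ i, e (n1 j) (n1 i) = 0 := fun i => eR _ _ (by rintro ⟨⟩)
    have t2' : ∀ i, e (n1 i) (n1 j) = 0 := fun i => eR _ _ (by rintro ⟨⟩)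
    have t3 : ∀ i, e (n1 j) (n2 i) = 0 := fun i => eR _ _ (by rintro ⟨⟩)
    have t3' : ∀ i, e (n2 i) (n1 j) = 0 := fun i => eR _ _ (by rintro ⟨⟩)
    have t4 : ∑ i, e (nJ i) (n1 j) = e (nJ j) (n1 j) :=
      Fintype.sum_eq_single j fun i hi => eR _ _ (by rintro ⟨⟩; exact hi rfl)
    have t6 : ∑ i, e (n1 j) (nJ i) = e (n1 j) (nJ j) :=
      Fintype.sum_eq_single j fun i hi => eR _ _ (by rintro ⟨⟩; exact hi rfl)
    simp only [t1, t1', t2, t2', t3, t3', t4, t6, sum_const_zero, sup2, Sum.elim_inr,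
      Sum.elim_inl] at this
    push_cast at this
    linarith
  have b2 : ∀ j, e (n2 j) (nJ j) + ∑ h, e (n2 j) (nM h)
      - (e (nJ j) (n2 j) + ∑ h, e (nM h) (n2 j)) = p1 j - 2 := by
    intro j
    have := eb (n2 j)
    rw [sum_nd, sum_nd] at this
    have t1 : e (n2 j) nS = 0 := eR _ _ (by rintro ⟨⟩)
    have t1' : e nS (n2 j) = 0 := eR _ _ (by rintro ⟨⟩)
    have t2 : ∀ i, e (n2 j) (n1 i) = 0 := fun i => eR _ _ (by rintro ⟨⟩)
    have t2' : ∀ i, e (n1 i) (n2 j) = 0 := fun i => eR _ _ (by rintro ⟨⟩)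
    have t3 : ∀ i, e (n2 j) (n2 i) = 0 := fun i => eR _ _ (by rintro ⟨⟩)
    have t3' : ∀ i, e (n2 i) (n2 j) = 0 := fun i => eR _ _ (by rintro ⟨⟩)
    have t4 : ∑ i, e (nJ i) (n2 j) = e (nJ j) (n2 j) :=
      Fintype.sum_eq_single j fun i hi => eR _ _ (by rintro ⟨⟩; exact hi rfl)
    have t6 : ∑ i, e (n2 j) (nJ i) = e (n2 j) (nJ j) :=
      Fintype.sum_eq_single j fun i hi => eR _ _ (by rintro ⟨⟩; exact hi rfl)
    simp only [t1, t1', t2, t2', t3, t3', t4, t6, sum_const_zero, sup2, Sum.elim_inr,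
      Sum.elim_inl] at this
    push_cast at this
    linarith
  have nG1 : ∀ h, h ∈ G1 → h ∉ G2 := fun h h1 h2 => (Finset.disjoint_left.1 c.disj) h1 h2
  have nG2 : ∀ h, h ∈ G2 → h ∉ G1 := fun h h1 h2 => (Finset.disjoint_left.1 c.disj) h2 h1
  have zu1 : ∀ j h, h ∉ G1 → e (n1 j) (nM h) = 0 := fun j h hh => eR _ _ (by
    rintro ⟨⟩; contradiction)
  have zd1 : ∀ j h, h ∉ G1 → e (nM h) (n1 j) = 0 := fun j h hh => eR _ _ (by
    rintro ⟨⟩; contradiction)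
  have zu2 : ∀ j h, h ∉ G2 → e (n2 j) (nM h) = 0 := fun j h hh => eR _ _ (by
    rintro ⟨⟩; contradiction)
  have zd2 : ∀ j h, h ∉ G2 → e (nM h) (n2 j) = 0 := fun j h hh => eR _ _ (by
    rintro ⟨⟩; contradiction)
  let dy : J → M → ℝ := fun j h =>
    (e (n1 j) (nM h) - e (nM h) (n1 j) + e (n2 j) (nM h) - e (nM h) (n2 j)) / 2
  have Y1 : ∀ j, ∑ h ∈ G1, dy j h = (∑ h, e (n1 j) (nM h) - ∑ h, e (nM h) (n1 j)) / 2 := by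
    intro j
    rw [← sum_sub_distrib, sum_div, ← Finset.sum_subset (Finset.subset_univ G1)]
    · refine sum_congr rfl fun h hh => ?_
      simp only [dy, zu2 j h (nG1 h hh), zd2 j h (nG1 h hh)]
      ring
    · intro h _ hh
      simp [zu1 j h hh, zd1 j h hh]
  have Y2 : ∀ j, ∑ h ∈ G2, dy j h = (∑ h, e (n2 j) (nM h) - ∑ h, e (nM h) (n2 j)) / 2 := by
    intro j
    rw [← sum_sub_distrib, sum_div, ← Finset.sum_subset (Finset.subset_univ G2)]
    · refine sum_congr rfl fun h hh => ?_
      simp only [dy, zu1 j h (nG2 h hh), zd1 j h (nG2 h hh)]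
      ring
    · intro h _ hh
      simp [zu2 j h hh, zd2 j h hh]
  refine c.no dy (fun j => (p1 j : ℝ) / 2) (fun j => (p2 j : ℝ) / 2) ?_ ?_ ?_ ?_ ?_ ?_ ?_ ?_ ?_ ?_
    ?_ ?_ ?_
  · rw [← sum_div]
    have : (∑ j, (p1 j : ℝ)) = 2 := by exact_mod_cast h1
    rw [this]; norm_num
  · rw [← sum_div]
    have : (∑ j, (p2 j : ℝ)) = 2 := by exact_mod_cast h2
    rw [this]; norm_num
  · intro j
    have : (0:ℝ) ≤ p1 j := by exact_mod_cast q1 j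
    positivity
  · intro j
    have : (0:ℝ) ≤ p2 j := by exact_mod_cast q2 j
    positivity
  · intro j hj
    exact z1 j (by rintro h; simp [h] at hj)
  · intro j hj
    exact z2 j (by rintro h; simp [h] at hj)
  · intro j hj
    have : (2:ℝ) ≤ p1 j + p2 j := by exact_mod_cast ht j hj
    linarith
  · intro h
    simp only [dy]
    rw [← sum_div, sum_sub_distrib, sum_add_distrib, sum_sub_distrib]
    linarith [bM h]
  · intro j hj
    rw [Y1, Y2]
    have t : e nS (nJ j) = 0 := eR _ _ (by rintro ⟨⟩; contradiction)
    linarith [bJ j, b1 j, b2 j, e0 (nJ j) nS]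
  · intro j h hy
    have t1 : e (n1 j) (nM h) = 0 := eR _ _ (by rintro ⟨⟩; contradiction)
    have t2 : e (n2 j) (nM h) = 0 := eR _ _ (by rintro ⟨⟩; contradiction)
    simp only [dy]
    linarith [e0 (nM h) (n1 j), e0 (nM h) (n2 j)]
  · intro j h hy
    have t1 : e (nM h) (n1 j) = 0 := eR _ _ (by rintro ⟨⟩; contradiction)
    have t2 : e (nM h) (n2 j) = 0 := eR _ _ (by rintro ⟨⟩; contradiction)
    simp only [dy]
    linarith [e0 (n1 j) (nM h), e0 (n2 j) (nM h)]
  · intro j hj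
    rw [Y1]
    have t : e (n1 j) (nJ j) = 0 := eR _ _ (by rintro ⟨⟩; contradiction)
    linarith [b1 j, e0 (nJ j) (n1 j)]
  · intro j hj
    rw [Y2]
    have t : e (n2 j) (nJ j) = 0 := eR _ _ (by rintro ⟨⟩; contradiction)
    linarith [b2 j, e0 (nJ j) (n2 j)]

/-- Facts about a closed set. -/
structure CF (G1 G2 : Finset M) (c1 c2 : J → ℤ)
    (y : J → M → ℝ) (x1 x2 : J → ℝ) (r w : ℝ) (T : Finset (Nd J M)) (g : J → ℝ) : Prop where
  sum : (kap T : ℝ) = ∑ j, g j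
  nn : ∀ j, 0 ≤ g j
  c01 : ∀ j, Cc T j = 0 ∨ Cc T j = 1
  d01 : ∀ j, Dd T j = 0 ∨ Dd T j = 1
  both : ∀ j, Cc T j = 1 → Dd T j = 1 → 1 ≤ g j
  both1 : ∀ j, Cc T j = 1 → Dd T j = 1 → g j = 1 → ∑ h ∈ G1, y j h + ∑ h ∈ G2, y j h = w
  c5 : ∀ j, Cc T j = 1 → c1 j + r - x2 j = ∑ h ∈ G1, y j h
  d5 : ∀ j, Dd T j = 1 → c2 j + r - x1 j = ∑ h ∈ G2, y j h
  c4 : ∀ j, Cc T j = 1 → Dd T j = 0 → g j = 0 → ∑ h ∈ G1, y j h = w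
  d4 : ∀ j, Dd T j = 1 → Cc T j = 0 → g j = 0 → ∑ h ∈ G2, y j h = w
  d4b : ∀ j, Dd T j = 1 → Cc T j = 0 → ∑ h ∈ G1, y j h = w → 1 ≤ g j

/-- Pointwise part of the cut facts. -/
def PF (C D : ℤ) (g Y1 Y2 w : ℝ) (p q : Prop) : Prop :=
  0 ≤ g ∧ (C = 0 ∨ C = 1) ∧ (D = 0 ∨ D = 1) ∧ (C = 1 → D = 1 → 1 ≤ g) ∧
  (C = 1 → D = 1 → g = 1 → Y1 + Y2 = w) ∧ (C = 1 → p) ∧ (D = 1 → q) ∧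
  (C = 1 → D = 0 → g = 0 → Y1 = w) ∧ (D = 1 → C = 0 → g = 0 → Y2 = w) ∧
  (D = 1 → C = 0 → Y1 = w → 1 ≤ g)

lemma PF00 {C D : ℤ} {g Y1 Y2 w : ℝ} {p q : Prop} (hC : C = 0) (hD : D = 0) (h : 0 ≤ g) :
    PF C D g Y1 Y2 w p q := by
  subst hC hD
  simp [PF, h]

lemma PF11 {C D : ℤ} {g Y1 Y2 w : ℝ} {p q : Prop} (hC : C = 1) (hD : D = 1) (h : 1 ≤ g)
    (h1 : g = 1 → Y1 + Y2 = w) (hp : p) (hq : q) :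
    PF C D g Y1 Y2 w p q := by
  subst hC hD
  have : 0 ≤ g := by linarith
  simp [PF, h, hp, hq, this]
  exact h1

lemma PF10 {C D : ℤ} {g Y1 Y2 w : ℝ} {p q : Prop} (hC : C = 1) (hD : D = 0) (h : 0 ≤ g)
    (h1 : g = 0 → Y1 = w) (hp : p) :
    PF C D g Y1 Y2 w p q := by
  subst hC hD
  simp [PF, h, hp]
  exact h1

lemma PF01 {C D : ℤ} {g Y1 Y2 w : ℝ} {p q : Prop} (hC : C = 0) (hD : D = 1) (h : 0 ≤ g)
    (h1 : g = 0 → Y2 = w) (h2 : Y1 = w → 1 ≤ g) (hq : q) :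
    PF C D g Y1 Y2 w p q := by
  subst hC hD
  simp [PF, h, hq]
  exact ⟨h1, h2⟩

lemma CF.mk' {T : Finset (Nd J M)} {g : J → ℝ} (h : (kap T : ℝ) = ∑ j, g j)
    (hp : ∀ j, PF (Cc T j) (Dd T j) (g j) (∑ h ∈ G1, y j h) (∑ h ∈ G2, y j h) w
      (c1 j + r - x2 j = ∑ h ∈ G1, y j h) (c2 j + r - x1 j = ∑ h ∈ G2, y j h)) :
    CF G1 G2 c1 c2 y x1 x2 r w T g := by
  constructor
  · exact h
  all_goals
    intro j
    obtain ⟨e1, e2, e3, e4, e5, e6, e7, e8, e9, e10⟩ := hp j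
    assumption

lemma cutFacts (c : Ctx G1 G2 b c1 c2 D y x1 x2 r w) (T : Finset (Nd J M))
    (hT : Cl G1 G2 b c1 c2 y x1 x2 r w T) : ∃ g, CF G1 G2 c1 c2 y x1 x2 r w T g := by
  classical
  have hwp := c.wpos
  have i1 : ∀ a, a ∈ T → ii T a = 1 := fun a ha => by simp [ii, ha]
  have i0 : ∀ a, a ∉ T → ii T a = 0 := fun a ha => by simp [ii, ha]
  -- closure facts
  have k1j : ∀ j, n1 j ∈ T → nJ j ∈ T := fun j hj => hT _ _ (Arc.j1 j) hj
  have k2j : ∀ j, n2 j ∈ T → nJ j ∈ T := fun j hj => hT _ _ (Arc.j2 j) hj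
  have sj : nS ∈ T → ∀ j, nJ j ∈ T := fun hs j => hT _ _ (Arc.js j) hs
  have tA : nS ∉ T → ∀ j, nJ j ∈ T → ∑ h ∈ G1, y j h + ∑ h ∈ G2, y j h = w := by
    intro hs j hj
    by_contra hne
    exact hs (hT _ _ (Arc.sj j hne) hj)
  have tC : ∀ j, nJ j ∈ T → n1 j ∉ T → c1 j + r - x2 j = ∑ h ∈ G1, y j h := by
    intro j hj hn
    by_contra hne
    exact hn (hT _ _ (Arc.k1 j hne) hj)
  have tD : ∀ j, nJ j ∈ T → n2 j ∉ T → c2 j + r - x1 j = ∑ h ∈ G2, y j h := by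
    intro j hj hn
    by_contra hne
    exact hn (hT _ _ (Arc.k2 j hne) hj)
  let I1 : J → ℝ := fun j => ∑ h ∈ G1, if nM h ∈ T then y j h else 0
  let O1 : J → ℝ := fun j => ∑ h ∈ G1, if nM h ∈ T then 0 else y j h
  let I2 : J → ℝ := fun j => ∑ h ∈ G2, if nM h ∈ T then y j h else 0
  let O2 : J → ℝ := fun j => ∑ h ∈ G2, if nM h ∈ T then 0 else y j h
  have S1 : ∀ j, ∑ h ∈ G1, y j h = I1 j + O1 j := by
    intro j
    simp only [I1, O1]
    rw [← sum_add_distrib]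
    exact sum_congr rfl fun h _ => by split_ifs <;> simp
  have S2 : ∀ j, ∑ h ∈ G2, y j h = I2 j + O2 j := by
    intro j
    simp only [I2, O2]
    rw [← sum_add_distrib]
    exact sum_congr rfl fun h _ => by split_ifs <;> simp
  have I1n : ∀ j, 0 ≤ I1 j := fun j => sum_nonneg fun h _ => by
    have := c.y0 j h
    split_ifs <;> simp [this]
  have I2n : ∀ j, 0 ≤ I2 j := fun j => sum_nonneg fun h _ => by
    have := c.y0 j h
    split_ifs <;> simp [this]
  have O1n : ∀ j, 0 ≤ O1 j := fun j => sum_nonneg fun h _ => by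
    have := c.y0 j h
    split_ifs <;> simp [this]
  have O2n : ∀ j, 0 ≤ O2 j := fun j => sum_nonneg fun h _ => by
    have := c.y0 j h
    split_ifs <;> simp [this]
  have O1z : ∀ j, n1 j ∈ T → O1 j = 0 := fun j hj => sum_eq_zero fun h hh => by
    split_ifs with hm
    · rfl
    · by_contra hne
      exact hm (hT _ _ (Arc.d1 j h hh hne) hj)
  have O2z : ∀ j, n2 j ∈ T → O2 j = 0 := fun j hj => sum_eq_zero fun h hh => by
    split_ifs with hm
    · rfl
    · by_contra hne
      exact hm (hT _ _ (Arc.d2 j h hh hne) hj)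
  have hA : ∀ j, I1 j + O1 j + (I2 j + O2 j) ≤ w := fun j => by
    rw [← S1, ← S2]
    exact c.hA j
  have split : ∀ f : M → ℝ, ∑ h, f h = ∑ h ∈ G1, f h + ∑ h ∈ G2, f h := by
    intro f
    rw [← sum_union c.disj]
    refine sum_congr ?_ fun _ _ => rfl
    ext h
    simpa using c.cover h
  have totI : ∑ j, (I1 j + I2 j) = (∑ h : M, (ii T (nM h) : ℝ)) * w := by
    have : ∀ j, I1 j + I2 j = ∑ h, if nM h ∈ T then y j h else 0 := fun j => by
      rw [split]
    simp only [this]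
    rw [sum_comm, sum_mul]
    refine sum_congr rfl fun h _ => ?_
    by_cases hm : (nM h : Nd J M) ∈ T
    · simp [hm, ii, c.col h]
    · simp [hm, ii]
  have totO : ∑ j, (O1 j + O2 j) = (Fintype.card M - ∑ h : M, (ii T (nM h) : ℝ)) * w := by
    have : ∀ j, O1 j + O2 j = ∑ h, if nM h ∈ T then 0 else y j h := fun j => by
      rw [split]
    simp only [this]
    rw [sum_comm]
    have e : (Fintype.card M - ∑ h : M, (ii T (nM h) : ℝ)) = ∑ h : M, (1 - (ii T (nM h) : ℝ)) := by
      simp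
    rw [e, sum_mul]
    refine sum_congr rfl fun h _ => ?_
    by_cases hm : (nM h : Nd J M) ∈ T
    · simp [hm, ii]
    · simp [hm, ii, c.col h]
  have dle : ∀ X : ℝ, X ≤ w → X / w ≤ 1 := fun X hX => (div_le_one hwp).2 hX
  have deq : ∀ X : ℝ, X / w = 1 → X = w := fun X hX => by
    rwa [div_eq_iff hwp.ne', one_mul] at hX
  have dz : ∀ X : ℝ, X / w = 0 → X = 0 := fun X hX => by
    rwa [div_eq_iff hwp.ne', zero_mul] at hX
  have dw : w / w = 1 := div_self hwp.ne'
  have dn : ∀ X : ℝ, 0 ≤ X → 0 ≤ X / w := fun X hX => div_nonneg hX hwp.le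
  by_cases hs : (nS : Nd J M) ∈ T
  · refine ⟨fun j => 2 - ii T (n1 j) - ii T (n2 j) - (O1 j + O2 j) / w, CF.mk' ?_ ?_⟩
    · rw [kap_eq]
      have : ∑ j : J, ii T (nJ j) = Fintype.card J := by
        simp [i1 _ (sj hs _)]
      rw [this, i1 _ hs]
      rw [sum_sub_distrib, ← sum_div, totO, mul_div_assoc, dw, sum_sub_distrib, sum_sub_distrib]
      push_cast
      simp
      ring
    · intro j
      have a1 := sj hs j
      have a2 := I1n j
      have a3 := I2n j
      have a4 := O1n j
      have a5 := O2n j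
      have a6 := hA j
      have a11 := dle (O1 j + O2 j) (by linarith)
      have a12 := deq (O1 j + O2 j)
      have a13 := dn (O1 j + O2 j) (by linarith)
      by_cases m1 : n1 j ∈ T <;> by_cases m2 : n2 j ∈ T
      · apply PF00
        · simp [Cc, i1 _ a1, i1 _ m1]
        · simp [Dd, i1 _ a1, i1 _ m2]
        · simp [i1 _ m1, i1 _ m2, O1z j m1, O2z j m2]
          norm_num
      · apply PF01
        · simp [Cc, i1 _ a1, i1 _ m1]
        · simp [Dd, i1 _ a1, i0 _ m2]
        · rw [i1 _ m1, i0 _ m2]; push_cast; linarith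
        · rw [i1 _ m1, i0 _ m2, S2]; push_cast
          intro h
          have := a12 (by linarith)
          have := O1z j m1
          linarith
        · rw [i1 _ m1, i0 _ m2, S1]; push_cast
          intro h
          have h1 := O1z j m1
          have h2 : O2 j = 0 := by linarith
          rw [h1, h2]; norm_num
        · exact tD j a1 m2
      · apply PF10
        · simp [Cc, i1 _ a1, i0 _ m1]
        · simp [Dd, i1 _ a1, i1 _ m2]
        · rw [i0 _ m1, i1 _ m2]; push_cast; linarith
        · rw [i0 _ m1, i1 _ m2, S1]; push_cast
          intro h
          have := a12 (by linarith)
          have := O2z j m2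
          linarith
        · exact tC j a1 m1
      · apply PF11
        · simp [Cc, i1 _ a1, i0 _ m1]
        · simp [Dd, i1 _ a1, i0 _ m2]
        · rw [i0 _ m1, i0 _ m2]; push_cast; linarith
        · rw [i0 _ m1, i0 _ m2, S1, S2]; push_cast
          intro h
          have := a12 (by linarith)
          linarith
        · exact tC j a1 m1
        · exact tD j a1 m2
  · refine ⟨fun j => (I1 j + I2 j) / w + ii T (nJ j) - ii T (n1 j) - ii T (n2 j), CF.mk' ?_ ?_⟩
    · rw [kap_eq]
      rw [i0 _ hs, sum_sub_distrib, sum_sub_distrib, sum_add_distrib, ← sum_div, totI,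
        mul_div_assoc, dw]
      push_cast
      ring
    · intro j
      have a2 := I1n j
      have a3 := I2n j
      have a4 := O1n j
      have a5 := O2n j
      have a6 := hA j
      have a12 := dz (I1 j + I2 j)
      have a13 := dn (I1 j + I2 j) (by linarith)
      by_cases a1 : nJ j ∈ T
      swap
      · have m1 : n1 j ∉ T := fun h => a1 (k1j j h)
        have m2 : n2 j ∉ T := fun h => a1 (k2j j h)
        apply PF00
        · simp [Cc, i0 _ a1, i0 _ m1]
        · simp [Dd, i0 _ a1, i0 _ m2]
        · rw [i0 _ m1, i0 _ m2, i0 _ a1]; push_cast; linarith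
      have t := tA hs j a1
      rw [S1, S2] at t
      by_cases m1 : n1 j ∈ T <;> by_cases m2 : n2 j ∈ T
      · apply PF00
        · simp [Cc, i1 _ a1, i1 _ m1]
        · simp [Dd, i1 _ a1, i1 _ m2]
        · have h1 := O1z j m1
          have h2 := O2z j m2
          have : I1 j + I2 j = w := by linarith
          rw [i1 _ m1, i1 _ m2, i1 _ a1, this, dw]
          norm_num
      · apply PF01
        · simp [Cc, i1 _ a1, i1 _ m1]
        · simp [Dd, i1 _ a1, i0 _ m2]
        · rw [i1 _ m1, i0 _ m2, i1 _ a1]; push_cast; linarith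
        · rw [i1 _ m1, i0 _ m2, i1 _ a1, S2]; push_cast
          intro h
          have := a12 (by linarith)
          have := O1z j m1
          linarith
        · rw [i1 _ m1, i0 _ m2, i1 _ a1, S1]; push_cast
          intro h
          have h1 := O1z j m1
          have h2 : I1 j + I2 j = w := by linarith
          rw [h2, dw]; norm_num
        · exact tD j a1 m2
      · apply PF10
        · simp [Cc, i1 _ a1, i0 _ m1]
        · simp [Dd, i1 _ a1, i1 _ m2]
        · rw [i0 _ m1, i1 _ m2, i1 _ a1]; push_cast; linarith
        · rw [i0 _ m1, i1 _ m2, i1 _ a1, S1]; push_cast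
          intro h
          have := a12 (by linarith)
          have := O2z j m2
          linarith
        · exact tC j a1 m1
      · apply PF11
        · simp [Cc, i1 _ a1, i0 _ m1]
        · simp [Dd, i1 _ a1, i0 _ m2]
        · rw [i0 _ m1, i0 _ m2, i1 _ a1]; push_cast; linarith
        · rw [S1, S2]
          exact fun _ => t
        · exact tC j a1 m1
        · exact tD j a1 m2


def Fr (x : ℝ) : Prop := ∀ z : ℤ, x ≠ z

lemma CF.gC (c : Ctx G1 G2 b c1 c2 D y x1 x2 r w) {T : Finset (Nd J M)} {g : J → ℝ}
    (f : CF G1 G2 c1 c2 y x1 x2 r w T g) {i : J} (h : Cc T i = 1) (hf : Fr (x2 i)) : 0 < g i := by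
  rcases f.d01 i with hd | hd
  · rcases (f.nn i).lt_or_eq with h0 | h0
    · exact h0
    · exfalso
      have e1 := f.c4 i h hd h0.symm
      have e2 := f.c5 i h
      have e3 := c.hw
      apply hf (c1 i - D)
      push_cast
      linarith
  · linarith [f.both i h hd]

lemma CF.gD (c : Ctx G1 G2 b c1 c2 D y x1 x2 r w) {T : Finset (Nd J M)} {g : J → ℝ}
    (f : CF G1 G2 c1 c2 y x1 x2 r w T g) {i : J} (h : Dd T i = 1) (hf : Fr (x1 i)) : 0 < g i := by
  rcases f.c01 i with hd | hd
  · rcases (f.nn i).lt_or_eq with h0 | h0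
    · exact h0
    · exfalso
      have e1 := f.d4 i h hd h0.symm
      have e2 := f.d5 i h
      have e3 := c.hw
      apply hf (c2 i - D)
      push_cast
      linarith
  · linarith [f.both i hd h]

lemma CF.le1 {T : Finset (Nd J M)} {g : J → ℝ}
    (f : CF G1 G2 c1 c2 y x1 x2 r w T g) (i : J) : g i ≤ kap T := by
  rw [f.sum]
  exact Finset.single_le_sum (fun j _ => f.nn j) (Finset.mem_univ i)

lemma CF.le2 {T : Finset (Nd J M)} {g : J → ℝ}
    (f : CF G1 G2 c1 c2 y x1 x2 r w T g) {i k : J} (h : i ≠ k) : g i + g k ≤ kap T := by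
  classical
  rw [f.sum, ← Finset.sum_pair h]
  exact Finset.sum_le_sum_of_subset_of_nonneg (Finset.subset_univ _) (fun j _ _ => f.nn j)

/-- some fractional coefficient at `i` is one -/
def Act (x1 x2 : J → ℝ) (T : Finset (Nd J M)) (i : J) : Prop :=
  (Cc T i = 1 ∧ Fr (x2 i)) ∨ (Dd T i = 1 ∧ Fr (x1 i))

lemma CF.act (c : Ctx G1 G2 b c1 c2 D y x1 x2 r w) {T : Finset (Nd J M)} {g : J → ℝ}
    (f : CF G1 G2 c1 c2 y x1 x2 r w T g) {i : J} (h : Act x1 x2 T i) : 0 < g i := by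
  rcases h with h | h
  · exact f.gC c h.1 h.2
  · exact f.gD c h.1 h.2

lemma CF.K0 [Nonempty J] {T : Finset (Nd J M)} {g : J → ℝ}
    (f : CF G1 G2 c1 c2 y x1 x2 r w T g) : 0 ≤ kap T := by
  have i : J := Classical.arbitrary J
  have := (f.nn i).trans (f.le1 i)
  exact_mod_cast this

lemma CF.K1 (c : Ctx G1 G2 b c1 c2 D y x1 x2 r w) {T : Finset (Nd J M)} {g : J → ℝ}
    (f : CF G1 G2 c1 c2 y x1 x2 r w T g) {i : J} (h : Act x1 x2 T i) : 1 ≤ kap T := by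
  have := (f.act c h).trans_le (f.le1 i)
  have : 0 < kap T := by exact_mod_cast this
  omega

lemma CF.K2a {T : Finset (Nd J M)} {g : J → ℝ}
    (f : CF G1 G2 c1 c2 y x1 x2 r w T g) {i : J} (h1 : Cc T i = 1) (h2 : Dd T i = 1) :
    1 ≤ kap T := by
  have := (f.both i h1 h2).trans (f.le1 i)
  exact_mod_cast this

lemma CF.K2 (c : Ctx G1 G2 b c1 c2 D y x1 x2 r w) {T : Finset (Nd J M)} {g : J → ℝ}
    (f : CF G1 G2 c1 c2 y x1 x2 r w T g) {i k : J} (h1 : Cc T i = 1) (h2 : Dd T i = 1)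
    (hk : i ≠ k) (h : Act x1 x2 T k) : 2 ≤ kap T := by
  have e1 := f.act c h
  have e2 := f.both i h1 h2
  have e3 := f.le2 hk
  have : (1:ℝ) < kap T := by linarith
  have : 1 < kap T := by exact_mod_cast this
  omega

lemma CF.K3 (c : Ctx G1 G2 b c1 c2 D y x1 x2 r w) {T : Finset (Nd J M)} {g : J → ℝ}
    (f : CF G1 G2 c1 c2 y x1 x2 r w T g) {i : J} (h1 : Cc T i = 1) (h2 : Dd T i = 1)
    (hk : kap T = 1) : ∃ z : ℤ, x1 i + x2 i = r + z := by
  have e2 := f.both i h1 h2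
  have e3 := f.le1 i
  rw [hk] at e3
  push_cast at e3
  have e4 := f.both1 i h1 h2 (by linarith)
  have e5 := f.c5 i h1
  have e6 := f.d5 i h2
  have e7 := c.hw
  refine ⟨c1 i + c2 i - D, ?_⟩
  push_cast
  linarith

lemma Cl.inter [DecidableEq (Nd J M)] {T T' : Finset (Nd J M)} (h : Cl G1 G2 b c1 c2 y x1 x2 r w T)
    (h' : Cl G1 G2 b c1 c2 y x1 x2 r w T') : Cl G1 G2 b c1 c2 y x1 x2 r w (T ∩ T') := by
  intro u v a hv
  rw [Finset.mem_inter] at hv ⊢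
  exact ⟨h u v a hv.1, h' u v a hv.2⟩

lemma Cl.union [DecidableEq (Nd J M)] {T T' : Finset (Nd J M)} (h : Cl G1 G2 b c1 c2 y x1 x2 r w T)
    (h' : Cl G1 G2 b c1 c2 y x1 x2 r w T') : Cl G1 G2 b c1 c2 y x1 x2 r w (T ∪ T') := by
  intro u v a hv
  rw [Finset.mem_union] at hv ⊢
  exact hv.imp (h u v a) (h' u v a)

lemma Ctx.lo1 (c : Ctx G1 G2 b c1 c2 D y x1 x2 r w) {j : J} (h : Fr (x1 j)) : 0 < x1 j :=
  lt_of_le_of_ne (c.x10 j) fun h0 => h 0 (by simp [← h0])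

lemma Ctx.lo2 (c : Ctx G1 G2 b c1 c2 D y x1 x2 r w) {j : J} (h : Fr (x2 j)) : 0 < x2 j :=
  lt_of_le_of_ne (c.x20 j) fun h0 => h 0 (by simp [← h0])

lemma dir2 [DecidableEq J] (c : Ctx G1 G2 b c1 c2 D y x1 x2 r w) (i1 i2 k1 k2 : J)
    (s1 t1 s2 t2 : ℤ)
    (h1 : s1 + t1 = 2) (h2 : s2 + t2 = 2) (q1 : 0 ≤ s1) (q2 : 0 ≤ t1) (q3 : 0 ≤ s2) (q4 : 0 ≤ t2)
    (z1 : s1 ≠ 0 → 0 < x1 i1) (z2 : t1 ≠ 0 → 0 < x1 k1) (z3 : s2 ≠ 0 → 0 < x2 i2)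
    (z4 : t2 ≠ 0 → 0 < x2 k2)
    (ht : ∀ j, x1 j + x2 j = r → 2 ≤ (if j = i1 then s1 else 0) + (if j = k1 then t1 else 0)
      + ((if j = i2 then s2 else 0) + (if j = k2 then t2 else 0))) :
    ∃ T g, Cl G1 G2 b c1 c2 y x1 x2 r w T ∧ CF G1 G2 c1 c2 y x1 x2 r w T g ∧
      2 * kap T < Cc T i2 * s2 + Cc T k2 * t2 + Dd T i1 * s1 + Dd T k1 * t1 := by
  obtain ⟨T, hT, h⟩ := dirfail c (fun j => (if j = i1 then s1 else 0) + (if j = k1 then t1 else 0))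
    (fun j => (if j = i2 then s2 else 0) + (if j = k2 then t2 else 0))
    (by simp [sum_add_distrib, h1]) (by simp [sum_add_distrib, h2])
    (by intro j; split_ifs <;> omega) (by intro j; split_ifs <;> omega)
    (by
      intro j hj
      by_cases e : j = i1 ∧ s1 ≠ 0
      · rw [e.1]; exact z1 e.2
      · by_cases e' : j = k1 ∧ t1 ≠ 0
        · rw [e'.1]; exact z2 e'.2
        · exfalso; apply hj
          split_ifs <;> simp_all)
    (by
      intro j hj
      by_cases e : j = i2 ∧ s2 ≠ 0
      · rw [e.1]; exact z3 e.2
      · by_cases e' : j = k2 ∧ t2 ≠ 0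
        · rw [e'.1]; exact z4 e'.2
        · exfalso; apply hj
          split_ifs <;> simp_all)
    ht
  obtain ⟨g, hg⟩ := cutFacts c T hT
  refine ⟨T, g, hT, hg, ?_⟩
  simp [mul_add, sum_add_distrib] at h
  linarith

lemma Ctx.two (c : Ctx G1 G2 b c1 c2 D y x1 x2 r w) {i k : J} (h : i ≠ k) :
    x1 i + x1 k ≤ r ∧ x2 i + x2 k ≤ r := by
  classical
  constructor
  · rw [← c.s1, ← Finset.sum_pair h]
    exact Finset.sum_le_sum_of_subset_of_nonneg (Finset.subset_univ _) (fun j _ _ => c.x10 j)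
  · rw [← c.s2, ← Finset.sum_pair h]
    exact Finset.sum_le_sum_of_subset_of_nonneg (Finset.subset_univ _) (fun j _ _ => c.x20 j)

lemma Ctx.tight2 (c : Ctx G1 G2 b c1 c2 D y x1 x2 r w) {i k j : J} (h : i ≠ k) (h1 : j ≠ i)
    (h2 : j ≠ k) (hi : x1 i + x2 i = r) (hk : x1 k + x2 k = r) : x1 j ≤ 0 := by
  classical
  have e : ∑ q ∈ ({j, i, k} : Finset J), (x1 q + x2 q) ≤ ∑ q, (x1 q + x2 q) :=
    Finset.sum_le_sum_of_subset_of_nonneg (Finset.subset_univ _)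
      (fun q _ _ => add_nonneg (c.x10 q) (c.x20 q))
  rw [Finset.sum_insert (by simp [h1, h2]), Finset.sum_pair h, sum_add_distrib, c.s1, c.s2] at e
  linarith [c.x20 j]

lemma caseB (c : Ctx G1 G2 b c1 c2 D y x1 x2 r w) {j0 i : J} (hne : i ≠ j0)
    (f1 : Fr (x1 j0)) (f2 : Fr (x2 j0)) (hi : x1 i + x2 i = r) (fi : Fr (x1 i)) (z : ℤ)
    (hz : x2 i = z) : False := by
  classical
  have p1 := c.lo1 f1
  have p2 := c.lo2 f2
  have pi := c.lo1 fi
  obtain ⟨t1, t2⟩ := c.two hne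
  have nt0 : x1 j0 + x2 j0 ≠ r := by
    intro h
    apply f1 z
    rw [← hz]
    linarith
  have pi2 : 0 < x2 i := by
    refine lt_of_le_of_ne (c.x20 i) fun h => ?_
    linarith
  have Q : ∀ q, x1 q + x2 q = r → q = i := by
    intro q hq
    by_contra hqi
    have : q ≠ j0 := by rintro rfl; exact nt0 hq
    have := c.tight2 hqi this.symm hne.symm hq hi
    linarith
  have : Nonempty J := ⟨j0⟩
  have Y : ∑ h ∈ G1, y i h = w := by
    obtain ⟨T, g, hT, f, h⟩ := dir2 c j0 j0 i i 1 1 1 1 (by norm_num) (by norm_num) (by norm_num)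
      (by norm_num) (by norm_num) (by norm_num) (fun _ => p1) (fun _ => pi) (fun _ => p2)
      (fun _ => pi2) (by
        intro q hq
        rw [Q q hq]
        simp [hne])
    have k0 := f.K0
    have A0 : Cc T j0 = 1 → Act x1 x2 T j0 := fun h => Or.inl ⟨h, f2⟩
    have A1 : Dd T j0 = 1 → Act x1 x2 T j0 := fun h => Or.inr ⟨h, f1⟩
    have A2 : Dd T i = 1 → Act x1 x2 T i := fun h => Or.inr ⟨h, fi⟩
    have m0 : Cc T j0 = 1 → 1 ≤ kap T := fun h => f.K1 c (A0 h)
    have m1 : Dd T j0 = 1 → 1 ≤ kap T := fun h => f.K1 c (A1 h)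
    have m2 : Dd T i = 1 → 1 ≤ kap T := fun h => f.K1 c (A2 h)
    have m3 : Cc T j0 = 1 → Dd T j0 = 1 → Dd T i = 1 → 2 ≤ kap T :=
      fun h1 h2 h3 => f.K2 c h1 h2 hne.symm (A2 h3)
    have m4 : Cc T i = 1 → Dd T i = 1 → Cc T j0 = 1 → 2 ≤ kap T :=
      fun h1 h2 h3 => f.K2 c h1 h2 hne (A0 h3)
    have m5 : Cc T i = 1 → Dd T i = 1 → Dd T j0 = 1 → 2 ≤ kap T :=
      fun h1 h2 h3 => f.K2 c h1 h2 hne (A1 h3)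
    have n1 := f.c01 j0
    have n2 := f.d01 j0
    have n3 := f.c01 i
    have n4 := f.d01 i
    have r1 : Cc T i = 1 := by omega
    have r2 : Dd T i = 0 := by omega
    refine f.c4 i r1 r2 ?_
    have gi := f.nn i
    by_cases hk : kap T = 0
    · have := f.le1 i
      rw [hk] at this
      push_cast at this
      linarith
    · have r3 : kap T = 1 := by omega
      have := f.both j0 (by omega) (by omega)
      have e := f.le2 hne
      rw [r3] at e
      push_cast at e
      linarith
  obtain ⟨T, g, hT, f, h⟩ := dir2 c i j0 i j0 2 0 2 0 (by norm_num) (by norm_num) (by norm_num)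
      (by norm_num) (by norm_num) (by norm_num) (fun _ => pi) (fun h => absurd rfl h) (fun _ => p2)
      (fun h => absurd rfl h) (by
        intro q hq
        rw [Q q hq]
        simp [hne])
  have k0 := f.K0
  have A0 : Cc T j0 = 1 → Act x1 x2 T j0 := fun h => Or.inl ⟨h, f2⟩
  have A2 : Dd T i = 1 → Act x1 x2 T i := fun h => Or.inr ⟨h, fi⟩
  have m0 : Cc T j0 = 1 → 1 ≤ kap T := fun h => f.K1 c (A0 h)
  have m2 : Dd T i = 1 → 1 ≤ kap T := fun h => f.K1 c (A2 h)
  have m4 : Cc T i = 1 → Dd T i = 1 → Cc T j0 = 1 → 2 ≤ kap T :=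
      fun h1 h2 h3 => f.K2 c h1 h2 hne (A0 h3)
  have n1 := f.c01 j0
  have n3 := f.c01 i
  have n4 := f.d01 i
  have e1 := f.d4b i (by omega) (by omega) Y
  have e2 := f.act c (A0 (by omega))
  have e3 := f.le2 hne
  have e4 : kap T = 1 := by omega
  rw [e4] at e3
  push_cast at e3
  linarith

lemma caseA (c : Ctx G1 G2 b c1 c2 D y x1 x2 r w) {j0 i : J} (hne : i ≠ j0)
    (f1 : Fr (x1 j0)) (f2 : Fr (x2 j0)) (hi : x1 i + x2 i = r) (fi : Fr (x1 i)) (fi2 : Fr (x2 i)) :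
    False := by
  classical
  have p1 := c.lo1 f1
  have p2 := c.lo2 f2
  have pi := c.lo1 fi
  have pi2 := c.lo2 fi2
  have Q : ∀ q, x1 q + x2 q = r → q = i ∨ q = j0 := by
    intro q hq
    by_contra hqi
    push Not at hqi
    have := c.tight2 hqi.1 hqi.2.symm hne.symm hq hi
    linarith
  have : Nonempty J := ⟨j0⟩
  obtain ⟨T, g, hT, f, h⟩ := dir2 c j0 j0 i i 1 1 1 1 (by norm_num) (by norm_num) (by norm_num)
      (by norm_num) (by norm_num) (by norm_num) (fun _ => p1) (fun _ => pi) (fun _ => p2)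
      (fun _ => pi2) (by
        intro q hq
        rcases Q q hq with rfl | rfl
        · simp [hne]
        · simp [hne.symm])
  have k0 := f.K0
  have A0 : Cc T j0 = 1 → Act x1 x2 T j0 := fun h => Or.inl ⟨h, f2⟩
  have A1 : Dd T j0 = 1 → Act x1 x2 T j0 := fun h => Or.inr ⟨h, f1⟩
  have A2 : Dd T i = 1 → Act x1 x2 T i := fun h => Or.inr ⟨h, fi⟩
  have A3 : Cc T i = 1 → Act x1 x2 T i := fun h => Or.inl ⟨h, fi2⟩
  have m0 : Cc T j0 = 1 → 1 ≤ kap T := fun h => f.K1 c (A0 h)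
  have m1 : Dd T j0 = 1 → 1 ≤ kap T := fun h => f.K1 c (A1 h)
  have m2 : Dd T i = 1 → 1 ≤ kap T := fun h => f.K1 c (A2 h)
  have m2' : Cc T i = 1 → 1 ≤ kap T := fun h => f.K1 c (A3 h)
  have m3 : Cc T j0 = 1 → Dd T j0 = 1 → Dd T i = 1 → 2 ≤ kap T :=
      fun h1 h2 h3 => f.K2 c h1 h2 hne.symm (A2 h3)
  have m3' : Cc T j0 = 1 → Dd T j0 = 1 → Cc T i = 1 → 2 ≤ kap T :=
      fun h1 h2 h3 => f.K2 c h1 h2 hne.symm (A3 h3)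
  have m4 : Cc T i = 1 → Dd T i = 1 → Cc T j0 = 1 → 2 ≤ kap T :=
      fun h1 h2 h3 => f.K2 c h1 h2 hne (A0 h3)
  have m5 : Cc T i = 1 → Dd T i = 1 → Dd T j0 = 1 → 2 ≤ kap T :=
      fun h1 h2 h3 => f.K2 c h1 h2 hne (A1 h3)
  have n1 := f.c01 j0
  have n2 := f.d01 j0
  have n3 := f.c01 i
  have n4 := f.d01 i
  omega

lemma notFr {x : ℝ} (h : ¬ Fr x) : ∃ z : ℤ, x = z := by
  simpa [Fr] using h

lemma case1 (c : Ctx G1 G2 b c1 c2 D y x1 x2 r w) {j0 i : J} (hne : i ≠ j0)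
    (f1 : Fr (x1 j0)) (f2 : Fr (x2 j0)) (hi : x1 i + x2 i = r) : False := by
  by_cases h1 : Fr (x1 i) <;> by_cases h2 : Fr (x2 i)
  · exact caseA c hne f1 f2 hi h1 h2
  · obtain ⟨z, hz⟩ := notFr h2
    exact caseB c hne f1 f2 hi h1 z hz
  · obtain ⟨z, hz⟩ := notFr h1
    exact caseB c.swap hne f2 f1 (by rw [add_comm]; exact hi) h2 z hz
  · obtain ⟨z, hz⟩ := notFr h1
    obtain ⟨z', hz'⟩ := notFr h2
    apply c.hr (z + z')
    push_cast
    linarith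

lemma exFr {x : J → ℝ} {j0 : J} (h : ∀ j, j ≠ j0 → ¬ Fr (x j)) :
    ∃ z : ℤ, ∑ j, x j = x j0 + z := by
  classical
  have h' : ∀ j, ∃ z : ℤ, j ≠ j0 → x j = z := by
    intro j
    by_cases hj : j = j0
    · exact ⟨0, fun h => absurd hj h⟩
    · obtain ⟨z, hz⟩ := notFr (h j hj)
      exact ⟨z, fun _ => hz⟩
  choose z hz using h'
  refine ⟨∑ j ∈ Finset.univ.erase j0, z j, ?_⟩
  rw [← Finset.add_sum_erase _ _ (Finset.mem_univ j0)]
  push_cast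
  congr 1
  exact sum_congr rfl fun j hj => hz j (Finset.ne_of_mem_erase hj)

lemma kap_mod [DecidableEq (Nd J M)] (T T' : Finset (Nd J M)) :
    kap (T ∩ T') + kap (T ∪ T') = kap T + kap T' := by
  rw [add_comm]
  exact Finset.sum_union_inter

lemma Cc_one {T : Finset (Nd J M)} {j : J} : Cc T j = 1 ↔ nJ j ∈ T ∧ n1 j ∉ T := by
  unfold Cc ii
  split_ifs <;> simp_all

lemma Dd_one {T : Finset (Nd J M)} {j : J} : Dd T j = 1 ↔ nJ j ∈ T ∧ n2 j ∉ T := by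
  unfold Dd ii
  split_ifs <;> simp_all

/-- Uncrossing contradiction. -/
lemma uncross (c : Ctx G1 G2 b c1 c2 D y x1 x2 r w) {j0 k : J} (hne : k ≠ j0)
    {T T' : Finset (Nd J M)}
    (hT : Cl G1 G2 b c1 c2 y x1 x2 r w T) (hT' : Cl G1 G2 b c1 c2 y x1 x2 r w T')
    (a2 : Dd T j0 = 1) (a4 : kap T = 1)
    (b1 : Cc T' j0 = 1) (b4 : kap T' = 1)
    (h : (Fr (x1 k) ∧ Dd T k = 1 ∧ Dd T' k = 1) ∨ (Fr (x2 k) ∧ Cc T k = 1 ∧ Cc T' k = 1)) :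
    False := by
  classical
  have hi := hT.inter hT'
  have hu := hT.union hT'
  have e := kap_mod T T'
  obtain ⟨g, f⟩ := cutFacts c _ hi
  obtain ⟨g', f'⟩ := cutFacts c _ hu
  have a2' := Dd_one.1 a2
  have b1' := Cc_one.1 b1
  have m1 : Cc (T ∩ T') j0 = 1 :=
    Cc_one.2 ⟨Finset.mem_inter.2 ⟨a2'.1, b1'.1⟩, fun h => b1'.2 (Finset.mem_inter.1 h).2⟩
  have m2 : Dd (T ∩ T') j0 = 1 :=
    Dd_one.2 ⟨Finset.mem_inter.2 ⟨a2'.1, b1'.1⟩, fun h => a2'.2 (Finset.mem_inter.1 h).1⟩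
  have m : Act x1 x2 (T ∩ T') k ∧ Act x1 x2 (T ∪ T') k := by
    rcases h with ⟨h0, h1, h2⟩ | ⟨h0, h1, h2⟩
    · have h1 := Dd_one.1 h1
      have h2 := Dd_one.1 h2
      refine ⟨Or.inr ⟨Dd_one.2 ⟨Finset.mem_inter.2 ⟨h1.1, h2.1⟩, fun h => ?_⟩, h0⟩,
        Or.inr ⟨Dd_one.2 ⟨Finset.mem_union.2 (Or.inl h1.1), fun h => ?_⟩, h0⟩⟩
      · exact h1.2 (Finset.mem_inter.1 h).1
      · exact (Finset.mem_union.1 h).elim h1.2 h2.2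
    · have h1 := Cc_one.1 h1
      have h2 := Cc_one.1 h2
      refine ⟨Or.inl ⟨Cc_one.2 ⟨Finset.mem_inter.2 ⟨h1.1, h2.1⟩, fun h => ?_⟩, h0⟩,
        Or.inl ⟨Cc_one.2 ⟨Finset.mem_union.2 (Or.inl h1.1), fun h => ?_⟩, h0⟩⟩
      · exact h1.2 (Finset.mem_inter.1 h).1
      · exact (Finset.mem_union.1 h).elim h1.2 h2.2
  have k1 := f.K2 c m1 m2 hne.symm m.1
  have k2 := f'.K1 c m.2
  omega

lemma case2a (c : Ctx G1 G2 b c1 c2 D y x1 x2 r w) {j0 : J}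
    (f1 : Fr (x1 j0)) (f2 : Fr (x2 j0)) (hQ : ∀ q, x1 q + x2 q = r → q = j0) :
    ∃ j1 j2, j1 ≠ j0 ∧ j2 ≠ j0 ∧ Fr (x2 j1) ∧ Fr (x1 j2) := by
  classical
  have : Nonempty J := ⟨j0⟩
  have p1 := c.lo1 f1
  have p2 := c.lo2 f2
  obtain ⟨T, g, hT, f, h⟩ := dir2 c j0 j0 j0 j0 2 0 2 0 (by norm_num) (by norm_num) (by norm_num)
      (by norm_num) (by norm_num) (by norm_num) (fun _ => p1) (fun h => absurd rfl h) (fun _ => p2)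
      (fun h => absurd rfl h) (by
        intro q hq
        rw [hQ q hq]
        simp)
  have k0 := f.K0
  have m0 : Cc T j0 = 1 → 1 ≤ kap T := fun h => f.K1 c (Or.inl ⟨h, f2⟩)
  have m2 : Dd T j0 = 1 → 1 ≤ kap T := fun h => f.K1 c (Or.inr ⟨h, f1⟩)
  have n1 := f.c01 j0
  have n2 := f.d01 j0
  obtain ⟨z, hz⟩ := f.K3 c (i := j0) (by omega) (by omega) (by omega)
  have u1 : ∃ j1, j1 ≠ j0 ∧ Fr (x2 j1) := by
    by_contra hcon
    push Not at hcon
    obtain ⟨z', hz'⟩ := exFr hcon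
    rw [c.s2] at hz'
    apply f1 (z + z')
    push_cast
    linarith
  have u2 : ∃ j2, j2 ≠ j0 ∧ Fr (x1 j2) := by
    by_contra hcon
    push Not at hcon
    obtain ⟨z', hz'⟩ := exFr hcon
    rw [c.s1] at hz'
    apply f2 (z + z')
    push_cast
    linarith
  obtain ⟨j1, h1⟩ := u1
  obtain ⟨j2, h2⟩ := u2
  exact ⟨j1, j2, h1.1, h2.1, h1.2, h2.2⟩

lemma case2 (c : Ctx G1 G2 b c1 c2 D y x1 x2 r w) {j0 : J}
    (f1 : Fr (x1 j0)) (f2 : Fr (x2 j0)) (hQ : ∀ q, x1 q + x2 q = r → q = j0) : False := by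
  classical
  obtain ⟨j1, j2, hj1, hj2, f3, f4⟩ := case2a c f1 f2 hQ
  have : Nonempty J := ⟨j0⟩
  have p1 := c.lo1 f1
  have p2 := c.lo2 f2
  have p3 := c.lo2 f3
  have p4 := c.lo1 f4
  -- middle direction
  obtain ⟨T, g, hT, f, h⟩ := dir2 c j0 j0 j2 j1 1 1 1 1 (by norm_num) (by norm_num) (by norm_num)
      (by norm_num) (by norm_num) (by norm_num) (fun _ => p1) (fun _ => p4) (fun _ => p2)
      (fun _ => p3) (by
        intro q hq
        rw [hQ q hq]
        simp [hj1.symm, hj2.symm])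
  have k0 := f.K0
  have m0 : Cc T j0 = 1 → 1 ≤ kap T := fun h => f.K1 c (Or.inl ⟨h, f2⟩)
  have m1 : Dd T j0 = 1 → 1 ≤ kap T := fun h => f.K1 c (Or.inr ⟨h, f1⟩)
  have m2 : Cc T j1 = 1 → 1 ≤ kap T := fun h => f.K1 c (Or.inl ⟨h, f3⟩)
  have m3 : Dd T j2 = 1 → 1 ≤ kap T := fun h => f.K1 c (Or.inr ⟨h, f4⟩)
  have m4 : Cc T j0 = 1 → Dd T j0 = 1 → Dd T j2 = 1 → 2 ≤ kap T :=
      fun h1 h2 h3 => f.K2 c h1 h2 hj2.symm (Or.inr ⟨h3, f4⟩)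
  have m5 : Cc T j0 = 1 → Dd T j0 = 1 → Cc T j1 = 1 → 2 ≤ kap T :=
      fun h1 h2 h3 => f.K2 c h1 h2 hj1.symm (Or.inl ⟨h3, f3⟩)
  have n1 := f.c01 j0
  have n2 := f.d01 j0
  have n3 := f.c01 j1
  have n4 := f.d01 j2
  have kT : kap T = 1 := by omega
  have eC : Cc T j1 = 1 := by omega
  have eD : Dd T j2 = 1 := by omega
  rcases n2 with hd | hd
  · -- second outer direction
    obtain ⟨T', g', hT', f', h'⟩ := dir2 c j0 j1 j0 j1 2 0 2 0 (by norm_num) (by norm_num)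
        (by norm_num)
        (by norm_num) (by norm_num) (by norm_num) (fun _ => p1) (fun h => absurd rfl h)
        (fun _ => p3) (fun h => absurd rfl h) (by
          intro q hq
          rw [hQ q hq]
          simp [hj1.symm])
    have k0 := f'.K0
    have m0 : Dd T' j0 = 1 → 1 ≤ kap T' := fun h => f'.K1 c (Or.inr ⟨h, f1⟩)
    have m2 : Cc T' j1 = 1 → 1 ≤ kap T' := fun h => f'.K1 c (Or.inl ⟨h, f3⟩)
    have n2 := f'.d01 j0
    have n3 := f'.c01 j1
    exact uncross c hj1 hT' hT (by omega) (by omega) (by omega) kT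
      (Or.inr ⟨f3, by omega, eC⟩)
  · obtain ⟨T', g', hT', f', h'⟩ := dir2 c j2 j0 j0 j0 2 0 2 0 (by norm_num) (by norm_num)
        (by norm_num)
        (by norm_num) (by norm_num) (by norm_num) (fun _ => p4) (fun h => absurd rfl h)
        (fun _ => p2) (fun h => absurd rfl h) (by
          intro q hq
          rw [hQ q hq]
          simp [hj2.symm])
    have k0 := f'.K0
    have m0 : Cc T' j0 = 1 → 1 ≤ kap T' := fun h => f'.K1 c (Or.inl ⟨h, f2⟩)
    have m2 : Dd T' j2 = 1 → 1 ≤ kap T' := fun h => f'.K1 c (Or.inr ⟨h, f4⟩)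
    have n2 := f'.c01 j0
    have n3 := f'.d01 j2
    exact uncross c hj2 hT hT' hd kT (by omega) (by omega)
      (Or.inl ⟨f4, eD, by omega⟩)

theorem Ctx.main (c : Ctx G1 G2 b c1 c2 D y x1 x2 r w) {j0 : J}
    (f1 : Fr (x1 j0)) (f2 : Fr (x2 j0)) : False := by
  by_cases h : ∃ i, i ≠ j0 ∧ x1 i + x2 i = r
  · obtain ⟨i, hi, ht⟩ := h
    exact case1 c hi f1 f2 ht
  · push Not at h
    exact case2 c f1 f2 fun q hq => by
      by_contra hne
      exact h q hne hq

end

lemma ev_nonneg {p q : ℝ} (hp : 0 ≤ p) (hq : p = 0 → 0 ≤ q) :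
    ∀ᶠ δ in nhdsWithin (0:ℝ) (Set.Ioi 0), 0 ≤ p + δ * q := by
  rcases hp.lt_or_eq with h | h
  · have ht : Filter.Tendsto (fun δ : ℝ => p + δ * q) (nhdsWithin (0:ℝ) (Set.Ioi 0))
        (nhds (p + 0 * q)) := by
      apply Filter.Tendsto.mono_left _ nhdsWithin_le_nhds
      exact (by fun_prop : Continuous fun δ : ℝ => p + δ * q).tendsto 0
    have := ht.eventually (lt_mem_nhds (show 0 < p + 0 * q by simpa using h))
    exact this.mono fun δ h => h.le
  · filter_upwards [self_mem_nhdsWithin] with δ hδ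
    have := mul_nonneg (le_of_lt (show (0:ℝ) < δ from hδ)) (hq h.symm)
    linarith

theorem no_crossing_job
    {J M : Type*} [Fintype J] [Fintype M] [DecidableEq J] [DecidableEq M]
    (G1 G2 : Finset M) (hG1ne : G1.Nonempty) (hG2ne : G2.Nonempty)
    (hdisj : Disjoint G1 G2) (hcover : G1 ∪ G2 = Finset.univ)
    (b : J → M → ℕ) (a1 a2 : J → ℕ)
    (ystar : J → M → ℝ) (x1star x2star : J → ℝ) (rstar wstar : ℝ)
    (hstar : FeasibleS G1 G2 b a1 a2 ystar x1star x2star rstar wstar)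
    (hstaropt : ∀ y' x1' x2' r' w', FeasibleS G1 G2 b a1 a2 y' x1' x2' r' w' →
      wstar - rstar ≤ w' - r')
    (y : J → M → ℝ) (x1 x2 : J → ℝ) (r w : ℝ)
    (hfeas : FeasibleLP G1 G2 b a1 a2 rstar wstar y x1 x2 r w)
    (hopt : ∀ y' x1' x2' r' w',
      FeasibleLP G1 G2 b a1 a2 rstar wstar y' x1' x2' r' w' → r ≤ r')
    (ε : ℝ) (hε0 : 0 < ε) (hε1 : ε < 1) (hrε : r = (⌊rstar⌋ : ℝ) + ε)
    (hsat1 : ∀ h ∈ G1, ((∑ j, y j h) = w) ∧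
      (w = (∑ j, (b j h : ℝ)) - ((∑ j, (a2 j : ℝ)) - r)))
    (hsat2 : ∀ h ∈ G2, ((∑ j, y j h) = w) ∧
      (w = (∑ j, (b j h : ℝ)) - ((∑ j, (a1 j : ℝ)) - r)))
    (B1 B2 : Finset J)
    (hB1 : ∀ j, j ∈ B1 ↔ ¬∃ z : ℤ, x1 j = (z : ℝ))
    (hB2 : ∀ j, j ∈ B2 ↔ ¬∃ z : ℤ, x2 j = (z : ℝ))
    :
    B1 ∩ B2 = ∅ := by
  have hcov : ∀ h, h ∈ G1 ∨ h ∈ G2 := fun h => by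
    have : h ∈ G1 ∪ G2 := by rw [hcover]; exact Finset.mem_univ h
    simpa using this
  have split : ∀ f : M → ℝ, ∑ h, f h = ∑ h ∈ G1, f h + ∑ h ∈ G2, f h := by
    intro f
    rw [← sum_union hdisj, hcover]
  obtain ⟨⟨F1, F2, F3, F4, F5, F6, F7, F8, F9, F10, F11⟩, F12, F13⟩ := hfeas
  have hrn : ∀ z : ℤ, r ≠ z := by
    intro z hz
    rw [hrε] at hz
    have h1 : (⌊rstar⌋ : ℝ) < z := by linarith
    have h2 : (z : ℝ) < ⌊rstar⌋ + 1 := by linarith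
    have h1' : ⌊rstar⌋ < z := by exact_mod_cast h1
    have h2' : z < ⌊rstar⌋ + 1 := by exact_mod_cast h2
    omega
  have hw : w = r + (⌈wstar - rstar⌉ : ℤ) := by linarith
  have hr0 : 0 < r := by
    refine lt_of_le_of_ne ?_ fun h => hrn 0 (by simp [← h])
    rw [← F5]
    exact sum_nonneg fun j _ => (F8 j).1
  have hw0 : 0 < w := by
    refine lt_of_le_of_ne ?_ fun h => hrn (-⌈wstar - rstar⌉) ?_
    · obtain ⟨h, hh⟩ := hG1ne
      rw [← (hsat1 h hh).1]
      exact sum_nonneg fun j _ => (F4 j h).1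
    · push_cast
      linarith
  have C : Ctx G1 G2 (fun j h => (b j h : ℝ))
      (fun j => ∑ h ∈ G1, (b j h : ℤ) + a2 j - ∑ j', (a2 j' : ℤ))
      (fun j => ∑ h ∈ G2, (b j h : ℤ) + a1 j - ∑ j', (a1 j' : ℤ)) ⌈wstar - rstar⌉ y x1 x2 r w := by
    refine ⟨hdisj, hcov, hw, hrn, hr0, hw0, ?_, ?_, fun j h => (F4 j h).1, fun j h => (F4 j h).2,
      F5, F6, F7, fun j => (F8 j).1, fun j => (F9 j).1, ?_, ?_, ?_⟩
    · intro h
      rcases hcov h with hh | hh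
      · exact (hsat1 h hh).1
      · exact (hsat2 h hh).1
    · intro j
      rw [← split]
      exact F3 j
    · intro j
      have := F10 j
      rw [sum_sub_distrib] at this
      push_cast
      linarith
    · intro j
      have := F11 j
      rw [sum_sub_distrib] at this
      push_cast
      linarith
    intro dy v1 v2 sv1 sv2 v10 v20 vx1 vx2 tB sdy tA tb t0 tC tD
    have e1 := Filter.eventually_all.2 fun j => ev_nonneg (p := w - ∑ h, y j h)
      (q := -1 - ∑ h, dy j h) (by linarith [F3 j]) (by
        intro h
        have h1 := split (y j)
        have h2 := split (dy j)
        have := tA j (by linarith)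
        linarith)
    have e2 := Filter.eventually_all.2 fun j => Filter.eventually_all.2 fun h =>
      ev_nonneg (p := y j h) (q := dy j h) (F4 j h).1 (t0 j h)
    have e3 := Filter.eventually_all.2 fun j => Filter.eventually_all.2 fun h =>
      ev_nonneg (p := b j h - y j h) (q := - dy j h) (by linarith [(F4 j h).2]) (by
        intro h0
        have := tb j h (by linarith)
        linarith)
    have e4 := Filter.eventually_all.2 fun j => ev_nonneg (p := r - x1 j - x2 j)
      (q := v1 j + v2 j - 1) (by linarith [F7 j]) (by
        intro h
        have := tB j (by linarith)
        linarith)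
    have e5 := Filter.eventually_all.2 fun j => ev_nonneg (p := x1 j)
      (q := - v1 j) (F8 j).1 (by
        intro h
        by_contra hne
        have := vx1 j (by rintro h0; simp [h0] at hne)
        linarith)
    have e6 := Filter.eventually_all.2 fun j => ev_nonneg (p := x2 j)
      (q := - v2 j) (F9 j).1 (by
        intro h
        by_contra hne
        have := vx2 j (by rintro h0; simp [h0] at hne)
        linarith)
    have e7 := Filter.eventually_all.2 fun j => ev_nonneg
      (p := (∑ j', (a2 j' : ℝ)) - r - ((∑ h ∈ G1, ((b j h : ℝ) - y j h)) + (a2 j : ℝ) - x2 j))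
      (q := ∑ h ∈ G1, dy j h + 1 - v2 j) (by linarith [F10 j]) (by
        intro h
        rw [sum_sub_distrib] at h
        have := tC j (by push_cast; linarith)
        linarith)
    have e8 := Filter.eventually_all.2 fun j => ev_nonneg
      (p := (∑ j', (a1 j' : ℝ)) - r - ((∑ h ∈ G2, ((b j h : ℝ) - y j h)) + (a1 j : ℝ) - x1 j))
      (q := ∑ h ∈ G2, dy j h + 1 - v1 j) (by linarith [F11 j]) (by
        intro h
        rw [sum_sub_distrib] at h
        have := tD j (by push_cast; linarith)
        linarith)
    have e9 := ev_nonneg (p := ε) (q := -1) hε0.le (fun h => absurd h hε0.ne')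
    have e10 : ∀ᶠ δ in nhdsWithin (0:ℝ) (Set.Ioi 0), δ ∈ Set.Ioi (0:ℝ) := self_mem_nhdsWithin
    obtain ⟨δ, g1, g2, g3, g4, g5, g6, g7, g8, g9, g10⟩ := (e1.and <| e2.and <| e3.and <| e4.and <|
      e5.and <| e6.and <| e7.and <| e8.and <| e9.and e10).exists
    have hδ : 0 < δ := g10
    have cl : ∀ h, ∑ j, (y j h + δ * dy j h) = ∑ j, y j h - δ := by
      intro h
      rw [sum_add_distrib, ← mul_sum, sdy h]
      ring
    have := hopt (fun j h => y j h + δ * dy j h) (fun j => x1 j - δ * v1 j)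
      (fun j => x2 j - δ * v2 j) (r - δ) (w - δ) (by
        refine ⟨⟨?_, ?_, ?_, ?_, ?_, ?_, ?_, ?_, ?_, ?_, ?_⟩, ?_, ?_⟩
        · intro h hh
          rw [cl]
          obtain ⟨k1, k2⟩ := hsat1 h hh
          constructor <;> linarith
        · intro h hh
          rw [cl]
          obtain ⟨k1, k2⟩ := hsat2 h hh
          constructor <;> linarith
        · intro j
          rw [sum_add_distrib, ← mul_sum]
          linarith [g1 j]
        · intro j h
          constructor
          · exact g2 j h
          · linarith [g3 j h]
        · rw [sum_sub_distrib, ← mul_sum, F5, sv1, mul_one]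
        · rw [sum_sub_distrib, ← mul_sum, F6, sv2, mul_one]
        · intro j
          linarith [g4 j]
        · intro j
          have := mul_nonneg hδ.le (v10 j)
          exact ⟨by linarith [g5 j], by linarith [(F8 j).2]⟩
        · intro j
          have := mul_nonneg hδ.le (v20 j)
          exact ⟨by linarith [g6 j], by linarith [(F9 j).2]⟩
        · intro j
          have k := g7 j
          rw [sum_sub_distrib] at k ⊢
          rw [sum_add_distrib, ← mul_sum]
          linarith
        · intro j
          have k := g8 j
          rw [sum_sub_distrib] at k ⊢
          rw [sum_add_distrib, ← mul_sum]
          linarith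
        · linarith
        · linarith)
    linarith
  rw [Finset.eq_empty_iff_forall_notMem]
  intro j hj
  rw [Finset.mem_inter, hB1, hB2] at hj
  exact C.main (j0 := j) (fun z hz => hj.1 ⟨z, hz⟩) (fun z hz => hj.2 ⟨z, hz⟩)
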